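/- For the StackMST(0,0) game whose red tree is a path P with at least 5 edges, all of whose edge costs lie in {a, b} with 0 ≤ a < b, and where σ denotes the number of bad a-blocks of P, the optimal revenue is exactly r*(P, c) = c(P) − min{ σ·a , ⌊σ/2⌋·(b − a) + (σ − 2·⌊σ/2⌋)·min{a, b − a} }. -/

import Mathlib

namespace StackMST

variable {V : Type*}

/-- Sum of an edge-weight function over a set of edges. -/
noncomputable def esum (w : Sym2 V → ℝ) (s : Set (Sym2 V)) : ℝ := ∑ᶠ e ∈ s, w e

/-- `M` is a spanning tree of `G`. -/
def IsSpanningTreeOf (G M : SimpleGraph V) : Prop := M ≤ G ∧ M.IsTree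

/-- Total weight of `M`, where red edges (the edges of `T`) are weighted by `c`
and all other (blue) edges are weighted by `p`. -/
noncomputable def weight (T : SimpleGraph V) (c p : Sym2 V → ℝ) (M : SimpleGraph V) : ℝ :=
  esum c (M.edgeSet ∩ T.edgeSet) + esum p (M.edgeSet \ T.edgeSet)

/-- Total price of the blue edges of `M`. -/
noncomputable def blueRevenue (T : SimpleGraph V) (p : Sym2 V → ℝ) (M : SimpleGraph V) : ℝ :=
  esum p (M.edgeSet \ T.edgeSet)

/-- The leader's revenue once `F` and `p` are fixed: the follower selects a
minimum-weight spanning tree of `T ⊔ F` and, among those, one maximizing the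
total price of the blue edges it contains. -/
noncomputable def followerRevenue (T : SimpleGraph V) (c : Sym2 V → ℝ)
    (F : SimpleGraph V) (p : Sym2 V → ℝ) : ℝ :=
  sSup {r | ∃ M : SimpleGraph V, IsSpanningTreeOf (T ⊔ F) M ∧
    (∀ M' : SimpleGraph V, IsSpanningTreeOf (T ⊔ F) M' →
        weight T c p M ≤ weight T c p M') ∧
    r = blueRevenue T p M}

/-- `F` is a set of blue edges: none of its edges is a red edge. -/
def IsBlueSet (T F : SimpleGraph V) : Prop := F ≤ Tᶜ

/-- `r(F)`: the best revenue the leader can obtain from the activated set `F`. -/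
noncomputable def revenueOf (T : SimpleGraph V) (c : Sym2 V → ℝ) (F : SimpleGraph V) : ℝ :=
  sSup {r | ∃ p : Sym2 V → ℝ, (∀ e ∈ F.edgeSet, 0 ≤ p e) ∧ r = followerRevenue T c F p}

/-- Optimal revenue `r*(T, c)` of the StackMST(0,0) game on the red tree `T`. -/
noncomputable def optRevenue (T : SimpleGraph V) (c : Sym2 V → ℝ) : ℝ :=
  sSup {r | ∃ (F : SimpleGraph V) (p : Sym2 V → ℝ), IsBlueSet T F ∧
    (∀ e ∈ F.edgeSet, 0 ≤ p e) ∧ r = followerRevenue T c F p}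

/-- Total cost `c(T)` of the red edges. -/
noncomputable def redCost (T : SimpleGraph V) (c : Sym2 V → ℝ) : ℝ := esum c T.edgeSet

/-- Optimal revenue of the budgeted game StackMST(γ, Δ). -/
noncomputable def gammaOptRevenue (T : SimpleGraph V) (c γ : Sym2 V → ℝ) (Δ : ℝ) : ℝ :=
  sSup {r | ∃ F : SimpleGraph V, IsBlueSet T F ∧ esum γ F.edgeSet ≤ Δ ∧
    r = revenueOf T c F}

end StackMST

namespace StackMST

/-- The `i`-th red edge of the path graph on `Fin (m+1)`,
joining vertex `i` to vertex `i+1`. -/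
def pathEdge (m : ℕ) (i : Fin m) : Sym2 (Fin (m+1)) := s(Fin.castSucc i, Fin.succ i)

/-- The consecutive edges `l, …, r` of the path form an `a`-block:
all of them have cost `a` and the run is maximal. -/
def IsABlock (m : ℕ) (c : Sym2 (Fin (m+1)) → ℝ) (a : ℝ) (l r : Fin m) : Prop :=
  l ≤ r ∧
  (∀ i : Fin m, l ≤ i → i ≤ r → c (pathEdge m i) = a) ∧
  (∀ i : Fin m, (i : ℕ) + 1 = (l : ℕ) → c (pathEdge m i) ≠ a) ∧
  (∀ i : Fin m, (r : ℕ) + 1 = (i : ℕ) → c (pathEdge m i) ≠ a)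

/-- A bad `a`-block: an `a`-block with at most 2 edges. -/
def IsBadBlock (m : ℕ) (c : Sym2 (Fin (m+1)) → ℝ) (a : ℝ) (l r : Fin m) : Prop :=
  IsABlock m c a l r ∧ (r : ℕ) ≤ (l : ℕ) + 1

/-- `σ`: the number of bad `a`-blocks of the path. -/
noncomputable def badBlockCount (m : ℕ) (c : Sym2 (Fin (m+1)) → ℝ) (a : ℝ) : ℕ :=
  Set.ncard {q : Fin m × Fin m | IsBadBlock m c a q.1 q.2}

/-- `min { σ·a , ⌊σ/2⌋·(b − a) + (σ − 2·⌊σ/2⌋)·min{a, b − a} }`. -/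
noncomputable def twoCostBound (a b : ℝ) (σ : ℕ) : ℝ :=
  min ((σ : ℝ) * a)
    (((σ / 2 : ℕ) : ℝ) * (b - a) + ((σ : ℝ) - 2 * ((σ / 2 : ℕ) : ℝ)) * min a (b - a))

end StackMST

open StackMST


section General
open Finset SimpleGraph
open scoped Classical

namespace StackMST

set_option linter.unusedSectionVars false

variable {V : Type*} [Fintype V]

/-- combined weight -/
noncomputable def cw (T : SimpleGraph V) (c p : Sym2 V → ℝ) (e : Sym2 V) : ℝ :=
  if e ∈ T.edgeSet then c e else p e

lemma esum_eq (w : Sym2 V → ℝ) (s : Set (Sym2 V)) : esum w s = ∑ e ∈ s.toFinset, w e := by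
  unfold esum
  rw [finsum_mem_eq_toFinset_sum]

lemma blueRevenue_eq (T : SimpleGraph V) (c p : Sym2 V → ℝ) (M : SimpleGraph V) :
    blueRevenue T p M = ∑ e ∈ M.edgeFinset.filter (fun e => e ∉ T.edgeSet), cw T c p e := by
  unfold blueRevenue
  rw [esum_eq]
  apply Finset.sum_congr
  · ext e; simp
  · intro e he
    simp at he
    simp [cw, he.2]

lemma weight_eq' (T : SimpleGraph V) (c p : Sym2 V → ℝ) (M : SimpleGraph V) :
    weight T c p M = ∑ e ∈ M.edgeFinset.filter (fun e => e ∈ T.edgeSet), c e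
      + blueRevenue T p M := by
  unfold weight blueRevenue
  congr 1
  rw [esum_eq]
  apply Finset.sum_congr
  · ext e; simp
  · intro e he; rfl

lemma weight_eq (T : SimpleGraph V) (c p : Sym2 V → ℝ) (M : SimpleGraph V) :
    weight T c p M = ∑ e ∈ M.edgeFinset, cw T c p e := by
  rw [weight_eq', blueRevenue_eq T c p, ← Finset.sum_filter_add_sum_filter_not M.edgeFinset (fun e => e ∈ T.edgeSet)]
  congr 1
  apply Finset.sum_congr rfl
  intro e he
  simp at he
  simp [cw, he.2]

/-- light edges of `M` -/
def light (M : SimpleGraph V) (w : Sym2 V → ℝ) (x : ℝ) : SimpleGraph V where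
  Adj u v := M.Adj u v ∧ w s(u, v) ≤ x
  symm := ⟨fun u v h => ⟨h.1.symm, by rw [Sym2.eq_swap]; exact h.2⟩⟩
  loopless := ⟨fun u h => M.loopless.irrefl u h.1⟩

lemma light_le (M : SimpleGraph V) (w : Sym2 V → ℝ) (x : ℝ) : light M w x ≤ M := fun _ _ h => h.1

lemma mem_light (M : SimpleGraph V) (w : Sym2 V → ℝ) (x : ℝ) (e : Sym2 V) :
    e ∈ (light M w x).edgeSet ↔ e ∈ M.edgeSet ∧ w e ≤ x := by
  induction e using Sym2.ind with
  | _ u v => rfl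

lemma exchange (G M : SimpleGraph V) (w : Sym2 V → ℝ) (hM : IsSpanningTreeOf G M)
    (hmin : ∀ M', IsSpanningTreeOf G M' → ∑ e ∈ M.edgeFinset, w e ≤ ∑ e ∈ M'.edgeFinset, w e)
    (u v : V) (huv : G.Adj u v) : (light M w (w s(u, v))).Reachable u v := by
  by_contra hn
  have hnM : ¬ M.Adj u v := fun h => hn (Adj.reachable (show _ ∧ _ from ⟨h, le_rfl⟩))
  have hac : (light M w (w s(u, v)) ⊔ edge u v).IsAcyclic :=
    IsAcyclic.sup_edge_of_not_reachable hn (hM.2.isAcyclic.anti (light_le _ _ _))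
  have hcon : (M ⊔ edge u v).Connected := hM.2.connected.mono le_sup_left
  obtain ⟨M', h1, h2, h3⟩ := hcon.exists_isTree_le_of_le_of_isAcyclic
    (sup_le_sup_right (light_le M w (w s(u, v))) (edge u v)) hac
  have hM'G : M' ≤ G := by
    refine h2.trans (sup_le hM.1 ?_)
    rw [edge_le_iff]; exact Or.inr huv
  have hw := hmin M' ⟨hM'G, h3⟩
  have c1 := hM.2.card_edgeFinset
  have c2 := h3.card_edgeFinset
  have heM : s(u, v) ∉ M.edgeFinset := by simpa using hnM
  have heM' : s(u, v) ∈ M'.edgeFinset := by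
    simp only [mem_edgeFinset, mem_edgeSet]
    apply h1
    right
    simp [edge_adj, huv.ne]
  have hsub : M'.edgeFinset.erase s(u, v) ⊆ M.edgeFinset := by
    intro e he
    rw [Finset.mem_erase, mem_edgeFinset] at he
    induction e using Sym2.ind with
    | _ x y =>
      have := h2 he.2
      rw [sup_adj, edge_adj] at this
      rcases this with h | h
      · simpa using h
      · exfalso; apply he.1; simpa using h.1
  have hcard : (M.edgeFinset \ M'.edgeFinset.erase s(u, v)).card = 1 := by
    rw [Finset.card_sdiff_of_subset hsub, Finset.card_erase_of_mem heM']
    have : 0 < M'.edgeFinset.card := Finset.card_pos.2 ⟨_, heM'⟩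
    omega
  obtain ⟨f, hf⟩ := Finset.card_eq_one.1 hcard
  have hfm : f ∈ M.edgeFinset \ M'.edgeFinset.erase s(u, v) := by rw [hf]; simp
  have hwf : w s(u, v) < w f := by
    by_contra hle
    push Not at hle
    rw [Finset.mem_sdiff, Finset.mem_erase] at hfm
    apply hfm.2
    refine ⟨fun h => heM (h ▸ hfm.1), ?_⟩
    rw [mem_edgeFinset]
    apply edgeSet_mono h1
    rw [edgeSet_sup]; left
    rw [mem_light]
    exact ⟨by simpa using hfm.1, hle⟩
  have e1 := Finset.sum_sdiff (f := w) hsub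
  rw [hf, Finset.sum_singleton] at e1
  have e2 := Finset.add_sum_erase _ w heM'
  linarith

/-- every finite graph has at least `n - #components` edges -/
lemma card_le_edges_add_comps [Nonempty V] (G : SimpleGraph V) :
    Fintype.card V ≤ G.edgeFinset.card + Fintype.card G.ConnectedComponent := by
  obtain ⟨v0⟩ := ‹Nonempty V›
  let E : Finset (Sym2 V) := ((univ : Finset G.ConnectedComponent).erase
    (G.connectedComponentMk v0)).image (fun k => s(v0, k.out))
  let G' := G ⊔ fromEdgeSet (E : Set (Sym2 V))
  have hout : ∀ x : V, G.Reachable (G.connectedComponentMk x).out x := fun x =>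
    ConnectedComponent.exact (Quot.out_eq _)
  have hcon : G'.Connected := by
    have : Nonempty V := ⟨v0⟩
    refine ⟨fun x y => ?_⟩
    have key : ∀ x, G'.Reachable v0 x := by
      intro x
      by_cases hx : G.connectedComponentMk x = G.connectedComponentMk v0
      · exact (ConnectedComponent.exact hx.symm).mono le_sup_left
      · have h1 : G'.Adj v0 (G.connectedComponentMk x).out := by
          right
          rw [fromEdgeSet_adj]
          constructor
          · simp only [E, Finset.coe_image, Set.mem_image]
            exact ⟨_, by simpa using hx, rfl⟩
          · intro h
            apply hx
            have := hout x
            rw [← h] at this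
            exact (ConnectedComponent.sound this).symm
        exact h1.reachable.trans ((hout x).mono le_sup_left)
    exact (key x).symm.trans (key y)
  have h1 := hcon.card_vert_le_card_edgeSet_add_one
  have h2 : G'.edgeFinset.card ≤ G.edgeFinset.card + E.card := by
    refine le_trans (Finset.card_le_card ?_) (Finset.card_union_le _ _)
    intro e he
    simp only [G', mem_edgeFinset, edgeSet_sup, edgeSet_fromEdgeSet] at he
    simp at he ⊢
    tauto
  have h3 : E.card + 1 ≤ Fintype.card G.ConnectedComponent := by
    have := Finset.card_image_le (s := (univ : Finset G.ConnectedComponent).erase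
      (G.connectedComponentMk v0)) (f := fun k => s(v0, k.out))
    rw [Finset.card_erase_of_mem (Finset.mem_univ _), Finset.card_univ] at this
    have h0 : 0 < Fintype.card G.ConnectedComponent :=
      Fintype.card_pos_iff.2 ⟨G.connectedComponentMk v0⟩
    show (Finset.image _ _).card + 1 ≤ _
    omega
  rw [Nat.card_eq_fintype_card, Nat.card_eq_fintype_card, ← edgeFinset_card] at h1
  omega

/-- a connected graph has at least `K - 1` edges between different classes -/
lemma card_outside [Nonempty V] (M : SimpleGraph V) (hM : M.Connected) (q : V → ℕ) :
    (univ.image q).card ≤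
      (M.edgeFinset.filter (fun e => ¬ (e.map q).IsDiag)).card + 1 := by
  let Q : SimpleGraph (univ.image q : Finset ℕ) := SimpleGraph.fromRel
    (fun k l => ∃ v w, M.Adj v w ∧ q v = k ∧ q w = l)
  let φ : V → (univ.image q : Finset ℕ) := fun v => ⟨q v, by simp⟩
  have hr : ∀ v w, M.Reachable v w → Q.Reachable (φ v) (φ w) := by
    intro v w ⟨W⟩
    induction W with
    | nil => rfl
    | cons h W ih =>
      rename_i x y z
      refine Reachable.trans ?_ ih
      by_cases hxy : φ x = φ y
      · rw [hxy]
      · apply Adj.reachable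
        rw [SimpleGraph.fromRel_adj]
        exact ⟨hxy, Or.inl ⟨x, y, h, rfl, rfl⟩⟩
  have hQ : Q.Connected := by
    obtain ⟨v0⟩ := ‹Nonempty V›
    have : Nonempty (univ.image q : Finset ℕ) := ⟨φ v0⟩
    refine ⟨?_⟩
    rintro ⟨k, hk⟩ ⟨l, hl⟩
    obtain ⟨v, -, rfl⟩ := Finset.mem_image.1 hk
    obtain ⟨w, -, rfl⟩ := Finset.mem_image.1 hl
    exact hr v w (hM.preconnected v w)
  have h1 := hQ.card_vert_le_card_edgeSet_add_one
  rw [Nat.card_eq_fintype_card, Nat.card_eq_fintype_card, ← edgeFinset_card] at h1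
  simp only [Fintype.card_coe] at h1
  refine h1.trans (Nat.add_le_add_right ?_ 1)
  have : Q.edgeFinset ⊆ (M.edgeFinset.filter (fun e => ¬ (e.map q).IsDiag)).image
      (fun e => e.map φ) := by
    intro e he
    induction e using Sym2.ind with
    | _ k l =>
      rw [mem_edgeFinset, mem_edgeSet, SimpleGraph.fromRel_adj] at he
      obtain ⟨hne, h⟩ := he
      rw [Finset.mem_image]
      rcases h with ⟨v, w, h, h1, h2⟩ | ⟨v, w, h, h1, h2⟩
      · refine ⟨s(v, w), ?_, ?_⟩
        · simp [h, h1, h2, hne]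
        · simp [φ, h1, h2]
      · refine ⟨s(w, v), ?_, ?_⟩
        · simp [h.symm, h1, h2, hne]
        · simp [φ, h1, h2]
  exact (Finset.card_le_card this).trans Finset.card_image_le

lemma fiber_count {α β : Type*} (L : Finset α) (f : α → β) :
    (L.filter (fun k => ∃ k' ∈ L, k' ≠ k ∧ f k' = f k)).card + 2 * (L.image f).card
      ≤ 2 * L.card := by
  let P : α → Prop := fun k => ∃ k' ∈ L, k' ≠ k ∧ f k' = f k
  change (L.filter P).card + _ ≤ _
  have h1 : (L.image f).card ≤ ((L.filter P).image f).card + ((L.filter (fun k => ¬ P k)).image f).card := by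
    refine le_trans (Finset.card_le_card ?_) (Finset.card_union_le _ _)
    rw [← Finset.image_union, Finset.filter_union_filter_not_eq]
  have h2 : ((L.filter (fun k => ¬ P k)).image f).card ≤ (L.filter (fun k => ¬ P k)).card :=
    Finset.card_image_le
  have h3 : 2 * ((L.filter P).image f).card ≤ (L.filter P).card := by
    apply Finset.mul_card_image_le_card
    intro x hx
    obtain ⟨k, hk, rfl⟩ := Finset.mem_image.1 hx
    obtain ⟨hkL, k', hk', hne, hf⟩ := Finset.mem_filter.1 hk
    apply Finset.one_lt_card.2
    refine ⟨k, by simp [hk], k', ?_, hne.symm⟩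
    simp only [Finset.mem_filter]
    exact ⟨⟨hk', k, hkL, hne.symm, hf.symm⟩, hf⟩
  have h4 := Finset.card_filter_add_card_filter_not (s := L) P
  omega

lemma bound_arith (a b : ℝ) (ha : 0 ≤ a) (hab : a < b) (σ r t : ℕ) (h : σ ≤ r + 2 * t) :
    twoCostBound a b σ ≤ t * (b - a) + r * a := by
  unfold twoCostBound
  have h' : (σ : ℝ) ≤ r + 2 * t := by exact_mod_cast h
  have hr : (0 : ℝ) ≤ r := by positivity
  have ht : (0 : ℝ) ≤ t := by positivity
  by_cases hd : 2 * a ≤ b - a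
  · refine (min_le_left _ _).trans ?_
    nlinarith
  · push Not at hd
    refine (min_le_right _ _).trans ?_
    rcases Nat.even_or_odd' σ with ⟨j, hj | hj⟩
    · have : σ / 2 = j := by omega
      rw [this]
      have e : (σ : ℝ) = 2 * j := by exact_mod_cast hj
      rw [e] at h' ⊢
      nlinarith
    · have : σ / 2 = j := by omega
      rw [this]
      have e : (σ : ℝ) = 2 * j + 1 := by exact_mod_cast hj
      rw [e] at h' ⊢
      have e2 : (2 * (j : ℝ) + 1 - 2 * j) = 1 := by ring
      rw [e2, one_mul]
      rcases Nat.eq_zero_or_pos r with h0 | h0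
      · subst h0
        have : j + 1 ≤ t := by omega
        have : (j : ℝ) + 1 ≤ t := by exact_mod_cast this
        have := min_le_right a (b - a)
        push_cast
        nlinarith
      · have h0' : (1 : ℝ) ≤ r := by exact_mod_cast h0
        have := min_le_left a (b - a)
        nlinarith

end StackMST
end General

section PathPart
open Finset SimpleGraph
open scoped Classical

namespace StackMST

variable {m : ℕ}

/-- number of non-`a` edges before vertex `k` -/
noncomputable def cnt (m : ℕ) (c : Sym2 (Fin (m+1)) → ℝ) (a : ℝ) (k : ℕ) : ℕ :=
  ((univ : Finset (Fin m)).filter (fun i => i.val < k ∧ c (pathEdge m i) ≠ a)).card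

lemma cnt_succ_eq (c : Sym2 (Fin (m+1)) → ℝ) (a : ℝ) (i : Fin m) (h : c (pathEdge m i) = a) :
    cnt m c a (i.val + 1) = cnt m c a i.val := by
  unfold cnt
  congr 1
  ext j
  simp only [Finset.mem_filter, Finset.mem_univ, true_and, and_congr_left_iff]
  intro hj
  have : j ≠ i := fun e => hj (e ▸ h)
  have : j.val ≠ i.val := fun e => this (Fin.ext e)
  omega

lemma cnt_succ_ne (c : Sym2 (Fin (m+1)) → ℝ) (a : ℝ) (i : Fin m) (h : c (pathEdge m i) ≠ a) :
    cnt m c a (i.val + 1) = cnt m c a i.val + 1 := by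
  unfold cnt
  rw [← Finset.card_insert_of_notMem (a := i) (by simp)]
  congr 1
  ext j
  simp only [Finset.mem_filter, Finset.mem_univ, true_and, Finset.mem_insert]
  constructor
  · rintro ⟨h1, h2⟩
    by_cases e : j = i
    · exact Or.inl e
    · have : j.val ≠ i.val := fun e' => e (Fin.ext e')
      exact Or.inr ⟨by omega, h2⟩
  · rintro (rfl | ⟨h1, h2⟩)
    · exact ⟨by omega, h⟩
    · exact ⟨by omega, h2⟩

lemma cnt_mono (c : Sym2 (Fin (m+1)) → ℝ) (a : ℝ) {k l : ℕ} (h : k ≤ l) :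
    cnt m c a k ≤ cnt m c a l := by
  unfold cnt
  apply Finset.card_le_card
  intro i
  simp only [Finset.mem_filter, Finset.mem_univ, true_and]
  rintro ⟨h1, h2⟩
  exact ⟨by omega, h2⟩

lemma cnt_zero (c : Sym2 (Fin (m+1)) → ℝ) (a : ℝ) : cnt m c a 0 = 0 := by
  unfold cnt; simp

lemma cost_of_cnt_eq (c : Sym2 (Fin (m+1)) → ℝ) (a : ℝ) (i : Fin m) {k l : ℕ}
    (hk : k ≤ i.val) (hl : i.val + 1 ≤ l) (h : cnt m c a k = cnt m c a l) :
    c (pathEdge m i) = a := by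
  by_contra hne
  have h1 := cnt_succ_ne c a i hne
  have h2 := cnt_mono c a hk
  have h3 := cnt_mono c a hl
  omega

lemma cnt_surj (c : Sym2 (Fin (m+1)) → ℝ) (a : ℝ) (v : ℕ) (hv : v ≤ m) :
    ∀ k ≤ cnt m c a v, ∃ u ≤ v, cnt m c a u = k := by
  induction v with
  | zero => intro k hk; exact ⟨0, le_rfl, by rw [cnt_zero] at *; omega⟩
  | succ v ih =>
    intro k hk
    by_cases h : k = cnt m c a (v+1)
    · exact ⟨v+1, le_rfl, h.symm⟩
    · have : k ≤ cnt m c a v := by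
        by_cases hc : c (pathEdge m ⟨v, by omega⟩) = a
        · have := cnt_succ_eq c a _ hc
          simp only at this
          omega
        · have := cnt_succ_ne c a _ hc
          simp only at this
          omega
      obtain ⟨u, hu, e⟩ := ih (by omega) k this
      exact ⟨u, by omega, e⟩

/-- labels -/
noncomputable def labels (m : ℕ) (c : Sym2 (Fin (m+1)) → ℝ) (a : ℝ) : Finset ℕ :=
  univ.image (fun v : Fin (m+1) => cnt m c a v.val)

lemma card_labels (c : Sym2 (Fin (m+1)) → ℝ) (a : ℝ) :
    (labels m c a).card = cnt m c a m + 1 := by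
  have : labels m c a = Finset.range (cnt m c a m + 1) := by
    ext k
    simp only [labels, Finset.mem_image, Finset.mem_univ, true_and, Finset.mem_range]
    constructor
    · rintro ⟨v, rfl⟩
      have := cnt_mono c a (show v.val ≤ m by omega)
      omega
    · intro hk
      obtain ⟨u, hu, e⟩ := cnt_surj c a m le_rfl k (by omega)
      exact ⟨⟨u, by omega⟩, e⟩
  rw [this, Finset.card_range]

lemma block_cnt (c : Sym2 (Fin (m+1)) → ℝ) (a : ℝ) {l r : Fin m} (h : IsABlock m c a l r)
    (v : ℕ) (hv : v ≤ m) : cnt m c a v = cnt m c a l.val ↔ l.val ≤ v ∧ v ≤ r.val + 1 := by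
  obtain ⟨hlr, h1, h2, h3⟩ := h
  constructor
  · intro e
    constructor
    · by_contra hlt
      push Not at hlt
      have := cost_of_cnt_eq c a ⟨l.val - 1, by omega⟩ (k := v) (l := l.val)
        (by simp; omega) (by simp; omega) e
      exact h2 ⟨l.val - 1, by omega⟩ (by simp; omega) this
    · by_contra hlt
      push Not at hlt
      have hlr' : l.val ≤ r.val := hlr
      have := cost_of_cnt_eq c a ⟨r.val + 1, by omega⟩ (k := l.val) (l := v)
        (by simp; omega) (by simp; omega) e.symm
      exact h3 ⟨r.val + 1, by omega⟩ (by simp) this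
  · rintro ⟨e1, e2⟩
    obtain ⟨d, rfl⟩ := Nat.exists_eq_add_of_le e1
    induction d with
    | zero => rfl
    | succ d ih =>
      rw [← ih (by omega) (by omega) (by omega)]
      have := cnt_succ_eq c a ⟨l.val + d, by omega⟩ (h1 _ (by simp [Fin.le_def])
        (by simp [Fin.le_def]; omega))
      simpa [add_assoc] using this

lemma block_inj (c : Sym2 (Fin (m+1)) → ℝ) (a : ℝ) {l r l' r' : Fin m}
    (h : IsABlock m c a l r) (h' : IsABlock m c a l' r')
    (e : cnt m c a l.val = cnt m c a l'.val) : l = l' ∧ r = r' := by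
  have b1 := fun v hv => block_cnt c a h v hv
  have b2 := fun v hv => block_cnt c a h' v hv
  rw [e] at b1
  have key : ∀ v ≤ m, (l.val ≤ v ∧ v ≤ r.val + 1) ↔ (l'.val ≤ v ∧ v ≤ r'.val + 1) :=
    fun v hv => (b1 v hv).symm.trans (b2 v hv)
  have hl : l.val ≤ r.val := h.1
  have hl' : l'.val ≤ r'.val := h'.1
  have k1 := key l.val (by omega)
  have k2 := key l'.val (by omega)
  have k3 := key (r.val+1) (by omega)
  have k4 := key (r'.val+1) (by omega)
  constructor <;> apply Fin.ext <;> omega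

/-- bad pairs -/
noncomputable def badPairs (m : ℕ) (c : Sym2 (Fin (m+1)) → ℝ) (a : ℝ) : Finset (Fin m × Fin m) :=
  univ.filter (fun q => IsBadBlock m c a q.1 q.2)

lemma card_badPairs (c : Sym2 (Fin (m+1)) → ℝ) (a : ℝ) :
    badBlockCount m c a = (badPairs m c a).card := by
  unfold badBlockCount badPairs
  rw [Set.ncard_eq_toFinset_card']
  congr 1
  ext q
  simp

lemma pathEdge_mem (i : Fin m) : pathEdge m i ∈ (pathGraph (m+1)).edgeSet := by
  unfold pathEdge
  rw [mem_edgeSet, pathGraph_adj]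
  left; simp

lemma pathEdge_inj : Function.Injective (pathEdge m) := by
  intro i j h
  unfold pathEdge at h
  rw [Sym2.eq_iff] at h
  rcases h with ⟨h, -⟩ | ⟨h1, h2⟩
  · exact Fin.castSucc_injective _ h
  · have e1 := congrArg Fin.val h1
    have e2 := congrArg Fin.val h2
    simp at e1 e2
    omega

lemma mem_path_edge (e : Sym2 (Fin (m+1))) (he : e ∈ (pathGraph (m+1)).edgeSet) :
    ∃ i : Fin m, e = pathEdge m i := by
  induction e using Sym2.ind with
  | _ u v =>
    rw [mem_edgeSet, pathGraph_adj] at he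
    rcases he with h | h
    · refine ⟨⟨u.val, by omega⟩, ?_⟩
      unfold pathEdge
      rw [Sym2.eq_iff]; left
      exact ⟨Fin.ext rfl, Fin.ext (by simp [h])⟩
    · refine ⟨⟨v.val, by omega⟩, ?_⟩
      unfold pathEdge
      rw [Sym2.eq_iff]; right
      exact ⟨Fin.ext (by simp [h]), Fin.ext rfl⟩

lemma edgeFinset_path : (pathGraph (m+1)).edgeFinset = univ.image (pathEdge m) := by
  ext e
  simp only [mem_edgeFinset, Finset.mem_image, Finset.mem_univ, true_and]
  constructor
  · intro h; obtain ⟨i, hi⟩ := mem_path_edge e h; exact ⟨i, hi.symm⟩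
  · rintro ⟨i, rfl⟩; exact pathEdge_mem i

lemma redCost_eq (c : Sym2 (Fin (m+1)) → ℝ) (a b : ℝ)
    (hc : ∀ e ∈ (pathGraph (m + 1)).edgeSet, c e = a ∨ c e = b) :
    redCost (pathGraph (m+1)) c = m * a + cnt m c a m * (b - a) := by
  unfold redCost
  rw [esum_eq]
  trans ∑ e ∈ univ.image (pathEdge m), c e
  · rw [← edgeFinset_path]; apply Finset.sum_congr _ (fun _ _ => rfl); ext; simp
  rw [Finset.sum_image (fun x _ y _ h => pathEdge_inj h)]
  have h2 : ∀ i : Fin m, c (pathEdge m i) = a + (if c (pathEdge m i) ≠ a then (b - a) else 0) := by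
    intro i
    by_cases h : c (pathEdge m i) = a
    · simp [h]
    · rcases hc _ (pathEdge_mem i) with h' | h'
      · exact absurd h' h
      · rw [if_pos h, h']; ring
  rw [Finset.sum_congr rfl (fun i _ => h2 i), Finset.sum_add_distrib, ← Finset.sum_filter]
  simp [cnt]
  ring

lemma path_isTree (m : ℕ) : (pathGraph (m+1)).IsTree := by
  rw [isTree_iff_connected_and_card]
  refine ⟨pathGraph_connected m, ?_⟩
  rw [Nat.card_eq_fintype_card, Nat.card_eq_fintype_card, ← edgeFinset_card, edgeFinset_path,
    Finset.card_image_of_injective _ pathEdge_inj]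
  simp

end StackMST
end PathPart

section Upper
open Finset SimpleGraph
open scoped Classical

namespace StackMST

variable {m : ℕ}

lemma cnt_reach (c : Sym2 (Fin (m+1)) → ℝ) (a : ℝ) (D : SimpleGraph (Fin (m+1)))
    (hD : ∀ i : Fin m, c (pathEdge m i) = a → D.Reachable i.castSucc i.succ)
    (v w : Fin (m+1)) (h : cnt m c a v = cnt m c a w) : D.Reachable v w := by
  have key : ∀ d : ℕ, ∀ v w : Fin (m+1), w.val = v.val + d → cnt m c a v = cnt m c a w →
      D.Reachable v w := by
    intro d
    induction d with
    | zero => intro v w h _; rw [show v = w from Fin.ext (by omega)]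
    | succ d ih =>
      intro v w hw h
      let i : Fin m := ⟨v.val + d, by omega⟩
      have hi : c (pathEdge m i) = a := cost_of_cnt_eq c a i (k := v) (l := w)
        (by simp [i]) (by simp [i, hw, add_assoc]) h
      have h1 := hD i hi
      have hs := cnt_succ_eq c a i hi
      have h2 := ih v i.castSucc (by simp [i]) (by
        rw [h, Fin.val_castSucc, ← hs]; congr 1)
      have : i.succ = w := Fin.ext (by simp [i]; omega)
      rw [← this]
      exact h2.trans h1
  rcases le_total v.val w.val with hvw | hvw
  · exact key (w.val - v.val) v w (by omega) h
  · exact (key (v.val - w.val) w v (by omega) h.symm).symm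

lemma exists_adj_of_reachable {V : Type*} (D : SimpleGraph V) (u v : V) (h : D.Reachable u v)
    (hne : u ≠ v) : ∃ y, D.Adj u y := by
  obtain ⟨W⟩ := h
  cases W with
  | nil => exact absurd rfl hne
  | cons h W => exact ⟨_, h⟩

lemma upper (a b : ℝ) (ha : 0 ≤ a) (hab : a < b)
    (c : Sym2 (Fin (m + 1)) → ℝ)
    (hc : ∀ e ∈ (pathGraph (m + 1)).edgeSet, c e = a ∨ c e = b)
    (F : SimpleGraph (Fin (m+1))) (p : Sym2 (Fin (m+1)) → ℝ)
    (M : SimpleGraph (Fin (m+1))) (hM : IsSpanningTreeOf (pathGraph (m+1) ⊔ F) M)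
    (hmin : ∀ M', IsSpanningTreeOf (pathGraph (m+1) ⊔ F) M' →
      weight (pathGraph (m+1)) c p M ≤ weight (pathGraph (m+1)) c p M') :
    blueRevenue (pathGraph (m+1)) p M ≤
      redCost (pathGraph (m + 1)) c - twoCostBound a b (badBlockCount m c a) := by
  set T := pathGraph (m+1) with hT
  set w := cw T c p with hw
  have hwred : ∀ e ∈ T.edgeSet, w e = c e := fun e he => by simp [hw, cw, he]
  have hex := exchange (T ⊔ F) M w hM (by
    intro M' h'
    have := hmin M' h'
    rwa [weight_eq, weight_eq] at this)
  have hedge : ∀ i : Fin m, T.Adj i.castSucc i.succ := fun i => pathEdge_mem i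
  have hex' : ∀ i : Fin m, (light M w (c (pathEdge m i))).Reachable i.castSucc i.succ := by
    intro i
    have := hex _ _ (show (T ⊔ F).Adj i.castSucc i.succ from Or.inl (hedge i))
    rwa [hwred _ (hedge i)] at this
  -- all edges cost at most b
  have hlb : M ≤ light M w b := by
    have hcon : (light M w b).Connected := by
      refine ⟨fun x y => ?_⟩
      apply cnt_reach (fun _ => 0) 0
      · intro i _
        refine (hex' i).mono ?_
        intro u v huv
        refine ⟨huv.1, huv.2.trans ?_⟩
        rcases hc _ (pathEdge_mem i) with h | h <;> rw [h]
        exact hab.le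
      · simp [cnt]
    exact (isTree_iff_minimal_connected.1 hM.2).2 hcon (light_le _ _ _)
  set D := light M w a with hD
  have hDM : D ≤ M := light_le _ _ _
  have hDr : ∀ i : Fin m, c (pathEdge m i) = a → D.Reachable i.castSucc i.succ := by
    intro i hi; have := hex' i; rwa [hi] at this
  have hDc := cnt_reach c a D hDr
  -- counting
  set R := D.edgeFinset.filter (fun e => e ∈ T.edgeSet) with hR
  set K := Fintype.card D.ConnectedComponent with hK
  have hx : m + 1 ≤ D.edgeFinset.card + K := by
    have := card_le_edges_add_comps D
    rw [Fintype.card_fin] at this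
    convert this
  have hMc : M.edgeFinset.card = m := by
    have := hM.2.card_edgeFinset
    simp at this; convert this
  have hDMc : D.edgeFinset ⊆ M.edgeFinset := by
    simpa using hDM
  -- label map
  let f : ℕ → D.ConnectedComponent := fun k =>
    if h : ∃ v : Fin (m+1), cnt m c a v = k then D.connectedComponentMk h.choose
    else D.connectedComponentMk 0
  have hf : ∀ v : Fin (m+1), f (cnt m c a v) = D.connectedComponentMk v := by
    intro v
    have h : ∃ u : Fin (m+1), cnt m c a u = cnt m c a v := ⟨v, rfl⟩
    simp only [f, dif_pos h]
    exact ConnectedComponent.sound (hDc _ _ h.choose_spec)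
  have himg : (labels m c a).image f = univ := by
    ext k
    simp only [Finset.mem_image, Finset.mem_univ, iff_true]
    induction k using ConnectedComponent.ind with
    | _ v => exact ⟨_, Finset.mem_image_of_mem _ (Finset.mem_univ v), hf v⟩
  have hfib := fiber_count (labels m c a) f
  rw [himg, Finset.card_univ, card_labels] at hfib
  have hKB : K ≤ cnt m c a m + 1 := by
    have := Finset.card_image_le (s := labels m c a) (f := f)
    rwa [himg, Finset.card_univ, card_labels] at this
  have hσ : badBlockCount m c a ≤ R.card + 2 * (cnt m c a m + 1 - K) := by
    rw [card_badPairs]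
    let P1 : Fin m × Fin m → Prop := fun q => ∃ i : Fin m, q.1 ≤ i ∧ i ≤ q.2 ∧ pathEdge m i ∈ D.edgeSet
    rw [← Finset.card_filter_add_card_filter_not (s := badPairs m c a) P1]
    have hcnti : ∀ q : Fin m × Fin m, IsBadBlock m c a q.1 q.2 → ∀ i, q.1 ≤ i → i ≤ q.2 →
        cnt m c a i = cnt m c a q.1 := by
      intro q hq i h1 h2
      rw [block_cnt c a hq.1 i (by omega)]
      have : i.val ≤ q.2.val := h2
      exact ⟨h1, by omega⟩
    have c1 : ((badPairs m c a).filter P1).card ≤ R.card := by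
      have : ∀ q : Fin m × Fin m, ∃ i : Fin m, P1 q → (q.1 ≤ i ∧ i ≤ q.2 ∧ pathEdge m i ∈ D.edgeSet) := by
        intro q
        by_cases h : P1 q
        · obtain ⟨i, hi⟩ := h; exact ⟨i, fun _ => hi⟩
        · exact ⟨q.1, fun h' => absurd h' h⟩
      choose g hg using this
      apply Finset.card_le_card_of_injOn (fun q => pathEdge m (g q))
      · intro q hq
        simp only [Finset.coe_filter, Set.mem_ofPred_eq] at hq
        simp only [hR, Finset.coe_filter, Set.mem_ofPred_eq, mem_edgeFinset]
        exact ⟨(hg q hq.2).2.2, pathEdge_mem _⟩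
      · intro q hq q' hq' e
        simp only [Finset.coe_filter, Set.mem_ofPred_eq, badPairs, Finset.mem_filter,
          Finset.mem_univ, true_and] at hq hq'
        have e := pathEdge_inj e
        have g1 := hg q hq.2
        have g2 := hg q' hq'.2
        have d1 := hcnti q hq.1 _ g1.1 g1.2.1
        have d2 := hcnti q' hq'.1 _ g2.1 g2.2.1
        rw [← e] at d2
        have := block_inj c a hq.1.1 hq'.1.1 (d1.symm.trans d2)
        exact Prod.ext this.1 this.2
    have c2 : ((badPairs m c a).filter (fun q => ¬ P1 q)).card ≤
        ((labels m c a).filter (fun k => ∃ k' ∈ labels m c a, k' ≠ k ∧ f k' = f k)).card := by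
      apply Finset.card_le_card_of_injOn (fun q => cnt m c a q.1)
      · intro q hq
        simp only [Finset.coe_filter, Set.mem_ofPred_eq, badPairs, Finset.mem_filter,
          Finset.mem_univ, true_and] at hq
        simp only [Finset.coe_filter, Set.mem_ofPred_eq]
        obtain ⟨⟨hb, hb2⟩, hn⟩ := hq
        obtain ⟨l, r⟩ := q
        simp only at hb hb2 hn ⊢
        have hlr : l.val ≤ r.val := hb.1
        refine ⟨Finset.mem_image_of_mem (fun v : Fin (m+1) => cnt m c a v.val) (Finset.mem_univ l.castSucc), ?_⟩
        by_contra hno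
        push Not at hno
        -- every vertex in D-component of l lies in block
        have hcomp : ∀ v : Fin (m+1), D.Reachable l.castSucc v → l.val ≤ v.val ∧ v.val ≤ r.val + 1 := by
          intro v hv
          rw [← block_cnt c a hb v.val (by omega)]
          by_contra hne
          refine hno (cnt m c a v) (Finset.mem_image_of_mem (fun v : Fin (m+1) => cnt m c a v.val) (Finset.mem_univ v)) hne ?_
          rw [hf, show cnt m c a l.val = cnt m c a (l.castSucc).val from rfl, hf]
          exact ConnectedComponent.sound hv.symm
        have hl1 : D.Reachable l.castSucc l.succ := by
          apply hDc
          symm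
          rw [Fin.val_castSucc, block_cnt c a hb _ (by omega)]
          simp; omega
        have hne : l.succ ≠ l.castSucc := by
          intro h; have := congrArg Fin.val h; simp at this
        obtain ⟨y, hy⟩ : ∃ y, D.Adj l.succ y := by
          exact exists_adj_of_reachable D _ _ hl1.symm hne
        have hyb := hcomp y (hl1.trans hy.reachable)
        have hyne : y.val ≠ l.val + 1 := by
          intro h
          exact hy.ne (Fin.ext (by simp [h]))
        apply hn
        by_cases hyl : y.val = l.val
        · refine ⟨l, le_rfl, hb.1, ?_⟩
          have : y = l.castSucc := Fin.ext (by simp [hyl])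
          unfold pathEdge
          rw [mem_edgeSet, ← this]
          exact hy.symm
        · have h2 : y.val = l.val + 2 := by omega
          refine ⟨r, hb.1, le_rfl, ?_⟩
          have e1 : y = r.succ := Fin.ext (by simp; omega)
          have e2 : l.succ = r.castSucc := Fin.ext (by simp; omega)
          unfold pathEdge
          rw [mem_edgeSet, ← e1, ← e2]
          exact hy
      · intro q hq q' hq' e
        simp only [Finset.coe_filter, Set.mem_ofPred_eq, badPairs, Finset.mem_filter,
          Finset.mem_univ, true_and] at hq hq'
        have := block_inj c a hq.1.1 hq'.1.1 e
        exact Prod.ext this.1 this.2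
    have hfib' : ((labels m c a).filter (fun k => ∃ k' ∈ labels m c a, k' ≠ k ∧ f k' = f k)).card
        + 2 * K ≤ 2 * (cnt m c a m + 1) := by convert hfib
    omega
  have harith := bound_arith a b ha hab _ _ _ hσ
  rw [redCost_eq c a b hc, blueRevenue_eq T c p]
  -- revenue bound
  have hrev : ∑ e ∈ M.edgeFinset.filter (fun e => e ∉ T.edgeSet), w e ≤
      ((D.edgeFinset.card : ℝ) - R.card) * a + (m - D.edgeFinset.card) * b := by
    rw [← Finset.sum_filter_add_sum_filter_not _ (fun e => e ∈ D.edgeSet)]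
    apply add_le_add
    · have hs : (M.edgeFinset.filter (fun e => e ∉ T.edgeSet)).filter (fun e => e ∈ D.edgeSet)
          = D.edgeFinset.filter (fun e => e ∉ T.edgeSet) := by
        ext e
        simp only [Finset.mem_filter, mem_edgeFinset]
        constructor
        · tauto
        · intro h; exact ⟨⟨edgeSet_mono hDM h.1, h.2⟩, h.1⟩
      rw [hs]
      have hcard := Finset.card_filter_add_card_filter_not (s := D.edgeFinset) (fun e => e ∈ T.edgeSet)
      have hcard' : ((D.edgeFinset.filter (fun e => e ∉ T.edgeSet)).card : ℝ) =
          (D.edgeFinset.card : ℝ) - R.card := by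
        rw [eq_sub_iff_add_eq, add_comm]; exact_mod_cast hcard
      rw [← hcard', ← nsmul_eq_mul]
      apply Finset.sum_le_card_nsmul
      intro e he
      simp only [Finset.mem_filter, mem_edgeFinset] at he
      exact ((mem_light _ _ _ _).1 he.1).2
    · have hs : ((M.edgeFinset.filter (fun e => e ∉ T.edgeSet)).filter (fun e => e ∉ D.edgeSet)).card
          ≤ m - D.edgeFinset.card := by
        have e1 := Finset.card_sdiff_of_subset hDMc
        rw [hMc] at e1
        rw [← e1]
        apply Finset.card_le_card
        intro e
        simp only [Finset.mem_filter, mem_edgeFinset, Finset.mem_sdiff]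
        tauto
      have hle : D.edgeFinset.card ≤ m := (Finset.card_le_card hDMc).trans hMc.le
      calc _ ≤ ((M.edgeFinset.filter (fun e => e ∉ T.edgeSet)).filter (fun e => e ∉ D.edgeSet)).card • b := by
            apply Finset.sum_le_card_nsmul
            intro e he
            simp only [Finset.mem_filter, mem_edgeFinset] at he
            exact ((mem_light _ _ _ _).1 (edgeSet_mono hlb he.1.1)).2
        _ ≤ (m - D.edgeFinset.card) * b := by
            rw [nsmul_eq_mul, ← Nat.cast_sub hle]
            have : (0 : ℝ) ≤ b := by linarith
            exact mul_le_mul_of_nonneg_right (by exact_mod_cast hs) this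
  refine hrev.trans ?_
  rw [Nat.cast_sub hKB] at harith
  push_cast at harith
  have hx' : (m : ℝ) + 1 ≤ D.edgeFinset.card + K := by exact_mod_cast hx
  nlinarith

end StackMST
end Upper

section Lower
open Finset SimpleGraph
open scoped Classical

namespace StackMST

variable {m : ℕ}

/-- in-class blue edges together with kept red edges -/
def keep (q : Fin (m+1) → ℕ) (R : Finset (Fin m)) : SimpleGraph (Fin (m+1)) where
  Adj u v := u ≠ v ∧ q u = q v ∧
    (¬ (pathGraph (m+1)).Adj u v ∨ ∃ i ∈ R, s(u, v) = pathEdge m i)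
  symm := ⟨fun u v h => ⟨h.1.symm, h.2.1.symm, by
    rw [SimpleGraph.adj_comm, Sym2.eq_swap]; exact h.2.2⟩⟩
  loopless := ⟨fun u h => h.1 rfl⟩

lemma keep_far (q : Fin (m+1) → ℕ) (R : Finset (Fin m)) (u v : Fin (m+1)) (h : q u = q v)
    (h2 : u.val + 2 ≤ v.val ∨ v.val + 2 ≤ u.val) : (keep q R).Reachable u v := by
  apply Adj.reachable
  refine ⟨fun e => by subst e; omega, h, Or.inl ?_⟩
  rw [pathGraph_adj]
  omega

/-- a class with at least four vertices is connected by blue edges -/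
lemma keep_four (q : Fin (m+1) → ℕ) (R : Finset (Fin m)) (u v : Fin (m+1)) (h : q u = q v)
    (h4 : 4 ≤ (univ.filter (fun x => q x = q u)).card) : (keep q R).Reachable u v := by
  have key : ∀ u v : Fin (m+1), q u = q v → 4 ≤ (univ.filter (fun x => q x = q u)).card →
      v.val = u.val + 1 → (keep q R).Reachable u v := by
    intro u v h h4 huv
    have hc : 1 < ((univ.filter (fun x => q x = q u)) \ {u, v}).card := by
      have h1 := Finset.le_card_sdiff ({u, v} : Finset (Fin (m+1))) (univ.filter (fun x => q x = q u))
      have h2 : ({u, v} : Finset (Fin (m+1))).card ≤ 2 := Finset.card_le_two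
      omega
    obtain ⟨x, hx, y, hy, hxy⟩ := Finset.one_lt_card.1 hc
    simp only [Finset.mem_sdiff, Finset.mem_filter, Finset.mem_univ, true_and,
      Finset.mem_insert, Finset.mem_singleton, not_or, Fin.ext_iff] at hx hy
    have hxy' : x.val ≠ y.val := fun e => hxy (Fin.ext e)
    have far := keep_far q R
    by_cases hx1 : x.val + 1 = u.val
    · by_cases hy1 : y.val = v.val + 1
      · exact ((far u y hy.1.symm (by omega)).trans (far y x (hy.1.trans hx.1.symm) (by omega))).trans
          (far x v (hx.1.trans h) (by omega))
      · exact (far u y hy.1.symm (by omega)).trans (far y v (hy.1.trans h) (by omega))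
    · by_cases hx2 : x.val = v.val + 1
      · by_cases hy1 : y.val + 1 = u.val
        · exact ((far u x hx.1.symm (by omega)).trans (far x y (hx.1.trans hy.1.symm) (by omega))).trans
            (far y v (hy.1.trans h) (by omega))
        · exact (far u y hy.1.symm (by omega)).trans (far y v (hy.1.trans h) (by omega))
      · exact (far u x hx.1.symm (by omega)).trans (far x v (hx.1.trans h) (by omega))
  by_cases h0 : u = v
  · rw [h0]
  have h0' : u.val ≠ v.val := fun e => h0 (Fin.ext e)
  by_cases h1 : v.val = u.val + 1
  · exact key u v h h4 h1
  by_cases h2 : u.val = v.val + 1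
  · exact (key v u h.symm (h ▸ h4) h2).symm
  exact keep_far q R u v h (by omega)

lemma compl_path_connected (hm : 3 ≤ m) : ((pathGraph (m+1))ᶜ).Connected := by
  refine ⟨fun u v => ?_⟩
  refine (keep_four (fun _ => 0) ∅ u v rfl (by simp; omega)).mono ?_
  intro x y h
  rw [compl_adj]
  refine ⟨h.1, ?_⟩
  have := h.2.2
  simpa using this

/-- value of a strategy -/
lemma strategy (hm : 5 ≤ m) (a b : ℝ) (ha : 0 ≤ a) (hab : a < b)
    (c : Sym2 (Fin (m + 1)) → ℝ)
    (hc : ∀ e ∈ (pathGraph (m + 1)).edgeSet, c e = a ∨ c e = b)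
    (q : Fin (m+1) → ℕ)
    (hq : ∀ i : Fin m, c (pathEdge m i) = a → q i.castSucc = q i.succ)
    (R : Finset (Fin m)) (hR : ∀ i ∈ R, c (pathEdge m i) = a)
    (hconn : ∀ v w, q v = q w → (keep q R).Reachable v w) :
    ∃ p : Sym2 (Fin (m+1)) → ℝ, (∀ e, 0 ≤ p e) ∧
      m * a + ((univ.image q).card - 1) * (b - a) - R.card * a ≤
        followerRevenue (pathGraph (m+1)) c (pathGraph (m+1))ᶜ p := by
  set T := pathGraph (m+1) with hT
  let p : Sym2 (Fin (m+1)) → ℝ := fun e => if (e.map q).IsDiag then a else b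
  set w := cw T c p with hw
  have hb : 0 ≤ b := by linarith
  refine ⟨p, fun e => by simp only [p]; split_ifs <;> assumption, ?_⟩
  have wa : ∀ e, a ≤ w e := by
    intro e
    simp only [hw, cw, p]
    split_ifs with h1 h2
    · rcases hc e h1 with h | h <;> rw [h]
      exact hab.le
    · exact le_rfl
    · exact hab.le
  have wb : ∀ e, ¬ (e.map q).IsDiag → w e = b := by
    intro e he
    simp only [hw, cw, p]
    split_ifs with h1
    · rcases hc e h1 with h | h
      · exfalso
        obtain ⟨i, rfl⟩ := mem_path_edge e h1
        apply he
        simpa [pathEdge] using hq i h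
      · exact h
    · rfl
  set K := (univ.image q).card with hK
  -- lower bound on weights
  have hlow : ∀ M' : SimpleGraph (Fin (m+1)), M'.IsTree →
      m * a + ((K : ℝ) - 1) * (b - a) ≤ ∑ e ∈ M'.edgeFinset, w e := by
    intro M' hM'
    have h1 := card_outside M' hM'.connected q
    have h2 : M'.edgeFinset.card = m := by
      have := hM'.card_edgeFinset
      simp at this; convert this
    have h3 : ∀ e ∈ M'.edgeFinset, a + (if ¬ (e.map q).IsDiag then (b - a) else 0) ≤ w e := by
      intro e _
      by_cases h : (e.map q).IsDiag
      · simpa [h] using wa e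
      · rw [if_pos h, wb e h]; linarith
    have h4 := Finset.sum_le_sum h3
    rw [Finset.sum_add_distrib, ← Finset.sum_filter, Finset.sum_const, Finset.sum_const, h2,
      nsmul_eq_mul, nsmul_eq_mul] at h4
    refine le_trans ?_ h4
    have h5 : (K : ℝ) - 1 ≤ (M'.edgeFinset.filter (fun e => ¬ (e.map q).IsDiag)).card := by
      rw [sub_le_iff_le_add]
      exact_mod_cast h1
    have : 0 ≤ b - a := by linarith
    nlinarith
  -- construct M
  set H := keep q R with hH
  obtain ⟨F, hFH, hFac, hFr⟩ := H.exists_isAcyclic_reachable_eq_le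
  have hcon : (F ⊔ Tᶜ).Connected := (compl_path_connected (by omega)).mono le_sup_right
  obtain ⟨M, hFM, hMle, hMt⟩ := hcon.exists_isTree_le_of_le_of_isAcyclic le_sup_left hFac
  have hMc : M.edgeFinset.card = m := by
    have := hMt.card_edgeFinset
    simp at this; convert this
  have hFMe : F.edgeFinset ⊆ M.edgeFinset := by simpa using hFM
  have hcomp : Fintype.card F.ConnectedComponent ≤ K := by
    rw [hK]
    have hinj : Function.Injective (fun k : F.ConnectedComponent => q k.out) := by
      intro k l hkl
      have := hconn _ _ hkl
      rw [← hFr] at this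
      have := ConnectedComponent.sound this
      have e1 : F.connectedComponentMk k.out = k := Quot.out_eq k
      have e2 : F.connectedComponentMk l.out = l := Quot.out_eq l
      rw [← e1, ← e2]; exact this
    rw [← Finset.card_univ, ← Finset.card_image_of_injective _ hinj]
    apply Finset.card_le_card
    intro x hx
    obtain ⟨k, -, rfl⟩ := Finset.mem_image.1 hx
    exact Finset.mem_image_of_mem _ (Finset.mem_univ _)
  have hFc : m + 1 ≤ F.edgeFinset.card + K := by
    have := card_le_edges_add_comps F
    rw [Fintype.card_fin] at this
    exact this.trans (Nat.add_le_add_left (by convert hcomp) _)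
  -- red edges of F come from R
  have hFred : ∀ e ∈ F.edgeSet, e ∈ T.edgeSet → ∃ i ∈ R, e = pathEdge m i := by
    intro e he heT
    induction e using Sym2.ind with
    | _ u v =>
      have := hFH he
      rcases this.2.2 with h | h
      · exact absurd heT h
      · exact h
  have hMred : ∀ e ∈ M.edgeSet, e ∈ T.edgeSet → e ∈ F.edgeSet := by
    intro e he heT
    induction e using Sym2.ind with
    | _ u v =>
      rcases hMle he with h | h
      · exact h
      · exact absurd heT ((compl_adj _ _ _).1 h).2
  have hFw : ∀ e ∈ F.edgeSet, w e = a := by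
    intro e he
    by_cases heT : e ∈ T.edgeSet
    · obtain ⟨i, hi, rfl⟩ := hFred e he heT
      simp only [hw, cw, if_pos heT]
      exact hR i hi
    · simp only [hw, cw, if_neg heT, p]
      rw [if_pos]
      induction e using Sym2.ind with
      | _ u v =>
        have := (hFH he).2.1
        simpa using this
  have hMw : ∀ e ∈ M.edgeSet, w e ≤ b := by
    intro e he
    by_cases heF : e ∈ F.edgeSet
    · rw [hFw e heF]; exact hab.le
    · have heT : e ∉ T.edgeSet := fun h => heF (hMred e he h)
      simp only [hw, cw, if_neg heT, p]
      split_ifs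
      · exact hab.le
      · exact le_rfl
  have hup : ∑ e ∈ M.edgeFinset, w e ≤ m * a + ((K : ℝ) - 1) * (b - a) := by
    rw [← Finset.sum_sdiff hFMe]
    have h1 : ∑ e ∈ F.edgeFinset, w e = F.edgeFinset.card * a := by
      rw [Finset.sum_congr rfl (fun e he => hFw e (by simpa using he)), Finset.sum_const, nsmul_eq_mul]
    have h2 : ∑ e ∈ M.edgeFinset \ F.edgeFinset, w e ≤ (M.edgeFinset \ F.edgeFinset).card • b := by
      apply Finset.sum_le_card_nsmul
      intro e he
      rw [Finset.mem_sdiff, mem_edgeFinset] at he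
      exact hMw e he.1
    have hle : F.edgeFinset.card ≤ m := (Finset.card_le_card hFMe).trans hMc.le
    rw [Finset.card_sdiff_of_subset hFMe, hMc, nsmul_eq_mul, Nat.cast_sub hle] at h2
    rw [h1]
    have h3 : (m : ℝ) + 1 ≤ F.edgeFinset.card + K := by exact_mod_cast hFc
    nlinarith
  have hwM := weight_eq T c p M
  have hge : m * a + ((K : ℝ) - 1) * (b - a) - R.card * a ≤ blueRevenue T p M := by
    have h1 := weight_eq' T c p M
    rw [hwM] at h1
    have h2 := hlow M hMt
    have h3 : ∑ e ∈ M.edgeFinset.filter (fun e => e ∈ T.edgeSet), c e ≤ R.card * a := by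
      have hsub : M.edgeFinset.filter (fun e => e ∈ T.edgeSet) ⊆ R.image (pathEdge m) := by
        intro e he
        simp only [Finset.mem_filter, mem_edgeFinset] at he
        obtain ⟨i, hi, rfl⟩ := hFred e (hMred e he.1 he.2) he.2
        exact Finset.mem_image_of_mem _ hi
      refine (Finset.sum_le_sum_of_subset_of_nonneg hsub ?_).trans ?_
      · intro e he _
        obtain ⟨i, hi, rfl⟩ := Finset.mem_image.1 he
        rw [hR i hi]; exact ha
      · rw [Finset.sum_image (fun x _ y _ h => pathEdge_inj h), Finset.sum_congr rfl hR,
          Finset.sum_const, nsmul_eq_mul]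
    linarith
  refine hge.trans ?_
  unfold followerRevenue
  apply le_csSup
  · apply Set.Finite.bddAbove
    apply (Set.finite_range (fun M : SimpleGraph (Fin (m+1)) => blueRevenue T p M)).subset
    rintro r ⟨M, -, -, rfl⟩
    exact ⟨M, rfl⟩
  · refine ⟨M, ⟨?_, hMt⟩, ?_, rfl⟩
    · rw [sup_compl_eq_top]; exact le_top
    · intro M' hM'
      rw [weight_eq, weight_eq]
      exact hup.trans (hlow M' hM'.2)

/-- bad labels -/
noncomputable def badLabels (m : ℕ) (c : Sym2 (Fin (m+1)) → ℝ) (a : ℝ) : Finset ℕ :=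
  (badPairs m c a).image (fun q => cnt m c a q.1)

lemma card_badLabels (c : Sym2 (Fin (m+1)) → ℝ) (a : ℝ) :
    (badLabels m c a).card = badBlockCount m c a := by
  rw [card_badPairs]
  apply Finset.card_image_of_injOn
  intro q hq q' hq' e
  simp only [badPairs, Finset.coe_filter, Finset.mem_univ, true_and, Set.mem_ofPred_eq] at hq hq'
  have := block_inj c a hq.1 hq'.1 e
  exact Prod.ext this.1 this.2

lemma mem_badLabels (c : Sym2 (Fin (m+1)) → ℝ) (a : ℝ) (k : ℕ) :
    k ∈ badLabels m c a ↔ ∃ l r, IsBadBlock m c a l r ∧ cnt m c a l.val = k := by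
  simp [badLabels, badPairs]

/-- a non-bad label with an inner edge has four vertices -/
lemma good_card (c : Sym2 (Fin (m+1)) → ℝ) (a : ℝ) (i : Fin m)
    (h : c (pathEdge m i) = a) (hn : cnt m c a i.val ∉ badLabels m c a) :
    4 ≤ (univ.filter (fun x : Fin (m+1) => cnt m c a x.val = cnt m c a i.val)).card := by
  have hs := cnt_succ_eq c a i h
  set k := cnt m c a i.val with hk
  set C := univ.filter (fun x : Fin (m+1) => cnt m c a x.val = k) with hC
  have hiC : i.castSucc ∈ C := by simp [hC, hk]
  have hiC' : i.succ ∈ C := by simp [hC, hs]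
  have hne : C.Nonempty := ⟨_, hiC⟩
  set l := C.min' hne with hl
  set r := C.max' hne with hr
  have hlC : cnt m c a l.val = k := by
    have := C.min'_mem hne; rw [← hl, hC] at this; simpa using this
  have hrC : cnt m c a r.val = k := by
    have := C.max'_mem hne; rw [← hr, hC] at this; simpa using this
  have hli : l.val ≤ i.val := C.min'_le _ hiC
  have hir : i.val + 1 ≤ r.val := C.le_max' _ hiC'
  have hrm : r.val ≤ m := by omega
  by_contra hlt
  push Not at hlt
  -- the class contains the interval [l, r]
  have hsub : Finset.Icc l r ⊆ C := by
    intro x hx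
    rw [Finset.mem_Icc] at hx
    have h1 := cnt_mono c a (show l.val ≤ x.val from hx.1)
    have h2 := cnt_mono c a (show x.val ≤ r.val from hx.2)
    simp only [hC, Finset.mem_filter, Finset.mem_univ, true_and]
    omega
  have hcard := Finset.card_le_card hsub
  rw [Fin.card_Icc] at hcard
  apply hn
  rw [mem_badLabels]
  refine ⟨⟨l.val, by omega⟩, ⟨r.val - 1, by omega⟩, ⟨⟨?_, ?_, ?_, ?_⟩, ?_⟩, hlC⟩
  · rw [Fin.le_def]; simp; omega
  · intro j h1 h2
    rw [Fin.le_def] at h1 h2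
    simp at h1 h2
    exact cost_of_cnt_eq c a j (k := l.val) (l := r.val) h1 (by omega) (hlC.trans hrC.symm)
  · intro j h1 h2
    simp at h1
    have h3 := cnt_succ_eq c a j h2
    rw [h1, hlC] at h3
    have : j.castSucc ∈ C := by simp [hC, h3]
    have := C.min'_le _ this
    rw [← hl, Fin.le_def] at this
    simp at this
    omega
  · intro j h1 h2
    simp at h1
    have h3 := cnt_succ_eq c a j h2
    have h4 : j.val = r.val := by omega
    rw [h4, hrC] at h3
    have : j.succ ∈ C := by simp [hC, h4, h3]
    have := C.le_max' _ this
    rw [← hr, Fin.le_def] at this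
    simp at this
    omega
  · simp; omega

/-- pairing lemma -/
lemma pairing (L S : Finset ℕ) (j : ℕ) (hj : 2 * j ≤ S.card) :
    ∃ S' ⊆ S, S'.card = 2 * j ∧ ∃ g : ℕ → ℕ, (∀ x, x ∉ S' → g x = x) ∧
      (∀ x ∈ S', g x ∈ S') ∧ (∀ x ∈ S', ∃ y ∈ S', y ≠ x ∧ g y = g x) ∧
      L.card ≤ (L.image g).card + j := by
  induction j with
  | zero => exact ⟨∅, by simp, by simp, id, by simp, by simp, by simp, by simp⟩
  | succ j ih =>
    obtain ⟨S', hS', hcard, g, g1, g2, g3, g4⟩ := ih (by omega)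
    have h1 : 1 < (S \ S').card := by
      rw [Finset.card_sdiff_of_subset hS']; omega
    obtain ⟨x, hx, y, hy, hxy⟩ := Finset.one_lt_card.1 h1
    rw [Finset.mem_sdiff] at hx hy
    refine ⟨insert x (insert y S'), ?_, ?_, Function.update g y x, ?_, ?_, ?_, ?_⟩
    · intro z hz
      simp only [Finset.mem_insert] at hz
      rcases hz with rfl | rfl | hz
      · exact hx.1
      · exact hy.1
      · exact hS' hz
    · rw [Finset.card_insert_of_notMem, Finset.card_insert_of_notMem hy.2]
      · omega
      · simp [hxy, hx.2]
    · intro z hz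
      simp only [Finset.mem_insert, not_or] at hz
      rw [Function.update_of_ne hz.2.1]
      exact g1 z hz.2.2
    · intro z hz
      by_cases hzy : z = y
      · subst hzy; simp
      · rw [Function.update_of_ne hzy]
        simp only [Finset.mem_insert] at hz ⊢
        rcases hz with rfl | rfl | hz
        · left; exact g1 _ hx.2
        · exact absurd rfl hzy
        · right; right; exact g2 z hz
    · intro z hz
      simp only [Finset.mem_insert] at hz
      rcases hz with rfl | rfl | hz
      · exact ⟨y, by simp, hxy.symm, by simp [Function.update_of_ne hxy, g1 _ hx.2]⟩
      · exact ⟨x, by simp, hxy, by simp [Function.update_of_ne hxy, g1 _ hx.2]⟩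
      · obtain ⟨z', hz', hne, he⟩ := g3 z hz
        refine ⟨z', by simp [hz'], hne, ?_⟩
        rw [Function.update_of_ne, Function.update_of_ne, he]
        · rintro rfl; exact hy.2 hz
        · rintro rfl; exact hy.2 hz'
    · have hsub : (L.image g).erase y ⊆ L.image (Function.update g y x) := by
        intro z hz
        rw [Finset.mem_erase, Finset.mem_image] at hz
        obtain ⟨hzy, u, hu, rfl⟩ := hz
        have : u ≠ y := by
          rintro rfl
          exact hzy (g1 _ hy.2)
        rw [Finset.mem_image]
        exact ⟨u, hu, Function.update_of_ne this _ _⟩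
      have := Finset.card_le_card hsub
      have h2 := Finset.pred_card_le_card_erase (s := L.image g) (a := y)
      omega

end StackMST
end Lower

section Final
open Finset SimpleGraph
open scoped Classical

namespace StackMST

variable {m : ℕ}

lemma reach_of_adj (q : Fin (m+1) → ℕ) (R : Finset (Fin m))
    (h : ∀ i : Fin m, q i.castSucc = q i.succ → (keep q R).Reachable i.castSucc i.succ)
    (u v : Fin (m+1)) (huv : q u = q v) : (keep q R).Reachable u v := by
  by_cases h0 : u.val = v.val
  · rw [Fin.ext h0]
  by_cases h1 : v.val = u.val + 1
  · obtain ⟨i, e1, e2⟩ : ∃ i : Fin m, u = i.castSucc ∧ v = i.succ :=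
      ⟨⟨u.val, by omega⟩, Fin.ext rfl, Fin.ext (by simp [h1])⟩
    rw [e1, e2] at huv ⊢
    exact h i huv
  by_cases h2 : u.val = v.val + 1
  · obtain ⟨i, e1, e2⟩ : ∃ i : Fin m, v = i.castSucc ∧ u = i.succ :=
      ⟨⟨v.val, by omega⟩, Fin.ext rfl, Fin.ext (by simp [h2])⟩
    rw [e1, e2] at huv ⊢
    exact (h i huv.symm).symm
  exact keep_far q R u v huv (by omega)

lemma two_bad_four (c : Sym2 (Fin (m+1)) → ℝ) (a : ℝ) (φ : ℕ → ℕ) (k y : ℕ)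
    (hk : k ∈ badLabels m c a) (hy : y ∈ badLabels m c a) (hne : y ≠ k) (he : φ y = φ k) :
    4 ≤ (univ.filter (fun x : Fin (m+1) => φ (cnt m c a x.val) = φ k)).card := by
  rw [mem_badLabels] at hk hy
  obtain ⟨l, r, hb, rfl⟩ := hk
  obtain ⟨l', r', hb', rfl⟩ := hy
  have e1 := cnt_succ_eq c a l (hb.1.2.1 l le_rfl hb.1.1)
  have e2 := cnt_succ_eq c a l' (hb'.1.2.1 l' le_rfl hb'.1.1)
  have hcard : ({l.castSucc, l.succ, l'.castSucc, l'.succ} : Finset (Fin (m+1))).card = 4 := by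
    have d1 : l.val ≠ l'.val := fun e => hne (by rw [e])
    have d2 : l.val ≠ l'.val + 1 := fun e => hne (by rw [e, e2])
    have d3 : l.val + 1 ≠ l'.val := fun e => hne (by rw [← e, e1])
    rw [Finset.card_insert_of_notMem, Finset.card_insert_of_notMem, Finset.card_insert_of_notMem,
      Finset.card_singleton]
    all_goals simp [Fin.ext_iff]
    all_goals omega
  rw [← hcard]
  apply Finset.card_le_card
  intro x hx
  simp only [Finset.mem_insert, Finset.mem_singleton] at hx
  simp only [Finset.mem_filter, Finset.mem_univ, true_and]
  rcases hx with rfl | rfl | rfl | rfl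
  · rfl
  · simp [e1]
  · simp [he]
  · simp [e2, he]

lemma image_comp (c : Sym2 (Fin (m+1)) → ℝ) (a : ℝ) (φ : ℕ → ℕ) :
    univ.image (fun v : Fin (m+1) => φ (cnt m c a v.val)) = (labels m c a).image φ := by
  unfold labels
  rw [Finset.image_image]; rfl

lemma cnt_class_four (c : Sym2 (Fin (m+1)) → ℝ) (a : ℝ) (φ : ℕ → ℕ) (i : Fin m)
    (h : cnt m c a i.val = cnt m c a (i.val + 1)) (hn : cnt m c a i.val ∉ badLabels m c a) :
    4 ≤ (univ.filter (fun x : Fin (m+1) => φ (cnt m c a x.val) = φ (cnt m c a i.val))).card := by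
  have hca := cost_of_cnt_eq c a i le_rfl le_rfl h
  refine (good_card c a i hca hn).trans (Finset.card_le_card ?_)
  intro x
  simp only [Finset.mem_filter, Finset.mem_univ, true_and]
  intro hx; rw [hx]

lemma scheme_pairs (hm : 5 ≤ m) (a b : ℝ) (ha : 0 ≤ a) (hab : a < b)
    (c : Sym2 (Fin (m + 1)) → ℝ)
    (hc : ∀ e ∈ (pathGraph (m + 1)).edgeSet, c e = a ∨ c e = b)
    (j : ℕ) (hj : 2 * j ≤ badBlockCount m c a) :
    ∃ p : Sym2 (Fin (m+1)) → ℝ, (∀ e, 0 ≤ p e) ∧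
      redCost (pathGraph (m+1)) c - (j * (b - a) + (badBlockCount m c a - 2 * j) * a) ≤
        followerRevenue (pathGraph (m+1)) c (pathGraph (m+1))ᶜ p := by
  obtain ⟨S', hS', hcard, g, g1, g2, g3, g4⟩ :=
    pairing (labels m c a) (badLabels m c a) j (by rwa [card_badLabels])
  let R : Finset (Fin m) := univ.filter
    (fun i => (∃ r, IsBadBlock m c a i r) ∧ cnt m c a i.val ∉ S')
  let q : Fin (m+1) → ℕ := fun v => g (cnt m c a v.val)
  have hRc : R.card ≤ badBlockCount m c a - 2 * j := by
    rw [← hcard, ← card_badLabels, ← Finset.card_sdiff_of_subset hS']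
    apply Finset.card_le_card_of_injOn (fun i => cnt m c a i.val)
    · intro i hi
      simp only [R, Finset.coe_filter, Finset.mem_univ, true_and, Set.mem_ofPred_eq] at hi
      obtain ⟨⟨r, hr⟩, hi⟩ := hi
      simp only [Finset.coe_sdiff, Set.mem_sdiff, Finset.mem_coe]
      exact ⟨(mem_badLabels c a _).2 ⟨i, r, hr, rfl⟩, hi⟩
    · intro i hi i' hi' e
      simp only [R, Finset.coe_filter, Finset.mem_univ, true_and, Set.mem_ofPred_eq] at hi hi'
      obtain ⟨⟨r, hr⟩, hi⟩ := hi
      obtain ⟨⟨r', hr'⟩, hi'⟩ := hi'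
      exact (block_inj c a hr.1 hr'.1 e).1
  have hS4 : ∀ v : Fin (m+1), cnt m c a v.val ∈ S' →
      4 ≤ (univ.filter (fun x => q x = q v)).card := by
    intro v hv
    obtain ⟨y, hy, hne, he⟩ := g3 _ hv
    exact two_bad_four c a g _ y (hS' hv) (hS' hy) hne he
  obtain ⟨p, hp, hval⟩ := strategy hm a b ha hab c hc q
    (by
      intro i hi
      have := cnt_succ_eq c a i hi
      simp [q, this]) R
    (by
      intro i hi
      simp only [R, Finset.mem_filter, Finset.mem_univ, true_and] at hi
      obtain ⟨⟨r, hr⟩, -⟩ := hi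
      exact hr.1.2.1 i le_rfl hr.1.1)
    (by
      apply reach_of_adj
      intro i hq
      by_cases h1 : cnt m c a i.castSucc.val ∈ S'
      · exact keep_four q R _ _ hq (hS4 _ h1)
      by_cases h2 : cnt m c a i.succ.val ∈ S'
      · exact (keep_four q R _ _ hq.symm (hS4 _ h2)).symm
      have hq' : cnt m c a i.val = cnt m c a (i.val + 1) := by
        have := hq
        simp only [q] at this
        rw [g1 _ h1, g1 _ h2] at this
        simpa using this
      by_cases hbad : cnt m c a i.val ∈ badLabels m c a
      · obtain ⟨l, r, hb, hl⟩ := (mem_badLabels c a _).1 hbad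
        have hlR : l ∈ R := by
          simp only [R, Finset.mem_filter, Finset.mem_univ, true_and]
          exact ⟨⟨r, hb⟩, by rw [hl]; exact h1⟩
        have b1 := (block_cnt c a hb.1 i.val (by omega)).1 hl.symm
        have b2 := (block_cnt c a hb.1 (i.val + 1) (by omega)).1 (hq'.symm.trans hl.symm)
        have b3 := hb.2
        have hlred : (keep q R).Reachable l.castSucc l.succ := by
          apply Adj.reachable
          refine ⟨fun e => by have := congrArg Fin.val e; simp at this, ?_, Or.inr ⟨l, hlR, rfl⟩⟩
          have := cnt_succ_eq c a l (hb.1.2.1 l le_rfl hb.1.1)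
          simp [q, this]
        by_cases hil : i = l
        · rw [hil]; exact hlred
        · have hil' : i.val = l.val + 1 := by
            have : i.val ≠ l.val := fun e => hil (Fin.ext e)
            omega
          have e1 : i.castSucc = l.succ := Fin.ext (by simp [hil'])
          rw [e1]
          refine hlred.symm.trans (keep_far q R _ _ ?_ ?_)
          · simp [q, hl, hq']
          · left; simp [hil']
      · exact keep_four q R _ _ hq (cnt_class_four c a g i hq' hbad))
  refine ⟨p, hp, le_trans ?_ hval⟩
  rw [redCost_eq c a b hc, image_comp]
  have i1 : (cnt m c a m : ℝ) + 1 ≤ ((labels m c a).image g).card + j := by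
    rw [card_labels] at g4; exact_mod_cast g4
  have i2 : (R.card : ℝ) ≤ badBlockCount m c a - 2 * j := by
    rw [le_sub_iff_add_le]
    have : R.card + 2 * j ≤ badBlockCount m c a := by omega
    exact_mod_cast this
  nlinarith

lemma scheme_odd (hm : 5 ≤ m) (a b : ℝ) (ha : 0 ≤ a) (hab : a < b)
    (c : Sym2 (Fin (m + 1)) → ℝ)
    (hc : ∀ e ∈ (pathGraph (m + 1)).edgeSet, c e = a ∨ c e = b)
    (j : ℕ) (hj : badBlockCount m c a = 2 * j + 1) :
    ∃ p : Sym2 (Fin (m+1)) → ℝ, (∀ e, 0 ≤ p e) ∧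
      redCost (pathGraph (m+1)) c - (j * (b - a) + (b - a)) ≤
        followerRevenue (pathGraph (m+1)) c (pathGraph (m+1))ᶜ p := by
  obtain ⟨S', hS', hcard, g, g1, g2, g3, g4⟩ :=
    pairing (labels m c a) (badLabels m c a) j (by rw [card_badLabels]; omega)
  have hone : (badLabels m c a \ S').card = 1 := by
    rw [Finset.card_sdiff_of_subset hS', card_badLabels]; omega
  obtain ⟨k0, hk0⟩ := Finset.card_eq_one.1 hone
  have hk0m : k0 ∈ badLabels m c a \ S' := by rw [hk0]; simp
  rw [Finset.mem_sdiff] at hk0m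
  obtain ⟨l, r, hb, hl⟩ := (mem_badLabels c a _).1 hk0m.1
  have hlr : l.val ≤ r.val := hb.1.1
  have hb2 := hb.2
  obtain ⟨x, hx⟩ : ∃ x : Fin (m+1), x.val + 2 ≤ l.val ∨ r.val + 3 ≤ x.val := by
    by_cases h : 2 ≤ l.val
    · exact ⟨0, by simp [h]⟩
    · exact ⟨⟨5, by omega⟩, by right; simp; omega⟩
  set kx := cnt m c a x.val with hkx
  have hkx0 : kx ≠ k0 := by
    intro h
    rw [hkx, ← hl, block_cnt c a hb.1 _ (by omega)] at h
    omega
  have hgkx : g kx ≠ k0 := by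
    by_cases h : kx ∈ S'
    · intro e; exact hk0m.2 (e ▸ g2 _ h)
    · rw [g1 _ h]; exact hkx0
  let φ : ℕ → ℕ := fun z => if g z = k0 then g kx else g z
  let q : Fin (m+1) → ℕ := fun v => φ (cnt m c a v.val)
  have hgk0 : g k0 = k0 := g1 _ hk0m.2
  have hφ0 : φ k0 = g kx := by simp [φ, hgk0]
  have hφx : φ kx = g kx := by simp [φ]
  have hS4 : ∀ v : Fin (m+1), cnt m c a v.val ∈ S' →
      4 ≤ (univ.filter (fun x => q x = q v)).card := by
    intro v hv
    obtain ⟨y, hy, hne, he⟩ := g3 _ hv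
    exact two_bad_four c a φ _ y (hS' hv) (hS' hy) hne (by simp [φ, he])
  have hls := cnt_succ_eq c a l (hb.1.2.1 l le_rfl hb.1.1)
  have hql : q l.castSucc = φ k0 := by simp [q, hl]
  have hql' : q l.succ = φ k0 := by simp [q, hls, hl]
  have hqx : q x = φ k0 := by simp only [q]; rw [← hkx, hφx, hφ0]
  obtain ⟨p, hp, hval⟩ := strategy hm a b ha hab c hc q
    (by
      intro i hi
      have := cnt_succ_eq c a i hi
      simp [q, this]) ∅ (by simp)
    (by
      apply reach_of_adj
      intro i hq
      by_cases h1 : cnt m c a i.castSucc.val ∈ S'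
      · exact keep_four q _ _ _ hq (hS4 _ h1)
      by_cases h2 : cnt m c a i.succ.val ∈ S'
      · exact (keep_four q _ _ _ hq.symm (hS4 _ h2)).symm
      by_cases h0 : q i.castSucc = φ k0
      · by_cases h4 : 4 ≤ (univ.filter (fun x => q x = q i.castSucc)).card
        · exact keep_four q _ _ _ hq h4
        · push Not at h4
          have hsub : ({l.castSucc, l.succ, x} : Finset (Fin (m+1))) ⊆
              univ.filter (fun x => q x = q i.castSucc) := by
            intro z hz
            simp only [Finset.mem_insert, Finset.mem_singleton] at hz
            simp only [Finset.mem_filter, Finset.mem_univ, true_and]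
            rw [h0]
            rcases hz with rfl | rfl | rfl <;> assumption
          have h3 : ({l.castSucc, l.succ, x} : Finset (Fin (m+1))).card = 3 := by
            rw [Finset.card_insert_of_notMem, Finset.card_insert_of_notMem, Finset.card_singleton]
            all_goals simp [Fin.ext_iff]
            all_goals omega
          have heq := Finset.eq_of_subset_of_card_le hsub (by omega)
          have m1 : i.castSucc ∈ ({l.castSucc, l.succ, x} : Finset (Fin (m+1))) := by
            rw [heq]; simp
          have m2 : i.succ ∈ ({l.castSucc, l.succ, x} : Finset (Fin (m+1))) := by
            rw [heq]; simp [hq]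
          simp [Fin.ext_iff] at m1 m2
          have hil : i = l := Fin.ext (by omega)
          rw [hil]
          refine (keep_far q _ _ x (hql.trans hqx.symm) ?_).trans
            (keep_far q _ x _ (hqx.trans hql'.symm) ?_)
          · simp; omega
          · simp; omega
      · have n1 : cnt m c a i.castSucc.val ≠ k0 := fun e => h0 (by simp only [q]; rw [e])
        have n2 : cnt m c a i.succ.val ≠ k0 := fun e => h0 (by rw [hq]; simp only [q]; rw [e])
        have hq' : cnt m c a i.val = cnt m c a (i.val + 1) := by
          have := hq
          simp only [q, φ] at this
          rw [g1 _ h1, g1 _ h2, if_neg n1, if_neg n2] at this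
          simpa using this
        have hnb : cnt m c a i.val ∉ badLabels m c a := by
          intro h
          have : cnt m c a i.val ∈ badLabels m c a \ S' := Finset.mem_sdiff.2 ⟨h, h1⟩
          rw [hk0, Finset.mem_singleton] at this
          exact n1 this
        exact keep_four q _ _ _ hq (cnt_class_four c a φ i hq' hnb))
  refine ⟨p, hp, le_trans ?_ hval⟩
  rw [redCost_eq c a b hc, image_comp]
  have hsub : ((labels m c a).image g).erase k0 ⊆ (labels m c a).image φ := by
    intro z hz
    rw [Finset.mem_erase, Finset.mem_image] at hz
    obtain ⟨hz0, u, hu, rfl⟩ := hz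
    exact Finset.mem_image.2 ⟨u, hu, by simp [φ, hz0]⟩
  have h5 := Finset.card_le_card hsub
  have h6 := Finset.pred_card_le_card_erase (s := (labels m c a).image g) (a := k0)
  have i1 : (cnt m c a m : ℝ) + 1 ≤ ((labels m c a).image φ).card + j + 1 := by
    rw [card_labels] at g4
    have : cnt m c a m + 1 ≤ ((labels m c a).image φ).card + j + 1 := by omega
    exact_mod_cast this
  simp only [Finset.card_empty, Nat.cast_zero, zero_mul, sub_zero]
  nlinarith

lemma follower_upper (a b : ℝ) (ha : 0 ≤ a) (hab : a < b)
    (c : Sym2 (Fin (m + 1)) → ℝ)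
    (hc : ∀ e ∈ (pathGraph (m + 1)).edgeSet, c e = a ∨ c e = b)
    (F : SimpleGraph (Fin (m+1))) (p : Sym2 (Fin (m+1)) → ℝ) :
    followerRevenue (pathGraph (m+1)) c F p ≤
      redCost (pathGraph (m + 1)) c - twoCostBound a b (badBlockCount m c a) := by
  unfold followerRevenue
  apply csSup_le
  · obtain ⟨M, hM, hmin⟩ := Set.exists_min_image
      {M : SimpleGraph (Fin (m+1)) | IsSpanningTreeOf (pathGraph (m+1) ⊔ F) M}
      (weight (pathGraph (m+1)) c p) (Set.toFinite _)
      ⟨pathGraph (m+1), le_sup_left, path_isTree m⟩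
    exact ⟨_, M, hM, hmin, rfl⟩
  · rintro r ⟨M, hM, hmin, rfl⟩
    exact upper a b ha hab c hc F p M hM hmin

lemma exists_strategy (hm : 5 ≤ m) (a b : ℝ) (ha : 0 ≤ a) (hab : a < b)
    (c : Sym2 (Fin (m + 1)) → ℝ)
    (hc : ∀ e ∈ (pathGraph (m + 1)).edgeSet, c e = a ∨ c e = b) :
    ∃ p : Sym2 (Fin (m+1)) → ℝ, (∀ e, 0 ≤ p e) ∧
      redCost (pathGraph (m+1)) c - twoCostBound a b (badBlockCount m c a) ≤
        followerRevenue (pathGraph (m+1)) c (pathGraph (m+1))ᶜ p := by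
  set σ := badBlockCount m c a with hσ
  unfold twoCostBound
  rcases min_choice ((σ : ℝ) * a) (((σ / 2 : ℕ) : ℝ) * (b - a) +
    ((σ : ℝ) - 2 * ((σ / 2 : ℕ) : ℝ)) * min a (b - a)) with h | h
  · rw [h]
    simpa using scheme_pairs hm a b ha hab c hc 0 (by omega)
  · rw [h]
    rcases Nat.even_or_odd' σ with ⟨j, hj | hj⟩
    · have e : σ / 2 = j := by omega
      have e' : (σ : ℝ) = 2 * j := by exact_mod_cast hj
      have := scheme_pairs hm a b ha hab c hc j (by omega)
      rw [← hσ] at this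
      rw [e, e'] 
      rw [e'] at this
      simpa using this
    · have e : σ / 2 = j := by omega
      have e' : (σ : ℝ) = 2 * j + 1 := by exact_mod_cast hj
      rw [e, e', show (2 * (j : ℝ) + 1 - 2 * j) = 1 by ring, one_mul]
      rcases min_choice a (b - a) with h' | h'
      · rw [h']
        have := scheme_pairs hm a b ha hab c hc j (by omega)
        rw [← hσ, e', show (2 * (j : ℝ) + 1 - 2 * j) = 1 by ring, one_mul] at this
        exact this
      · rw [h']
        exact scheme_odd hm a b ha hab c hc j hj

end StackMST
end Final

/-- For the StackMST(0,0) game whose red tree is a path with at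
least 5 edges, all of whose edge costs lie in `{a, b}` with `0 ≤ a < b`, and where
`σ` is the number of bad `a`-blocks of the path, the optimal revenue is exactly
`r* = c(P) − min{σa, ⌊σ/2⌋(b−a) + (σ − 2⌊σ/2⌋)·min{a, b−a}}`. -/
theorem stackMST_path_twoCosts_exact
    (m : ℕ) (hm : 5 ≤ m) (a b : ℝ) (ha : 0 ≤ a) (hab : a < b)
    (c : Sym2 (Fin (m + 1)) → ℝ)
    (hc : ∀ e ∈ (SimpleGraph.pathGraph (m + 1)).edgeSet, c e = a ∨ c e = b) :
    optRevenue (SimpleGraph.pathGraph (m + 1)) c =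
      redCost (SimpleGraph.pathGraph (m + 1)) c - twoCostBound a b (badBlockCount m c a) := by
  apply le_antisymm
  · apply csSup_le
    · exact ⟨_, ⊥, fun _ => 0, bot_le, by simp, rfl⟩
    · rintro r ⟨F, p, -, -, rfl⟩
      exact follower_upper a b ha hab c hc F p
  · obtain ⟨p, hp, h⟩ := exists_strategy hm a b ha hab c hc
    refine h.trans ?_
    apply le_csSup
    · refine ⟨redCost (SimpleGraph.pathGraph (m + 1)) c -
        twoCostBound a b (badBlockCount m c a), ?_⟩
      rintro r ⟨F, p, -, -, rfl⟩
      exact follower_upper a b ha hab c hc F p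
    · exact ⟨_, p, le_rfl, fun e _ => hp e, rfl⟩
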